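/- Let $m > 0$ and positive constants $k_{tp}, k_{td}, k_{ti}, \sigma_1, c_1$ with $c_1 < \min(\sqrt{k_{tp}},\, \tfrac{4 k_{tp} k_{td}}{k_{td}^2 + 4 k_{tp}})$, and let $\Delta_p \in \mathbb{R}^3$ be constant with $k_{ti}\sigma_1 > \|\Delta_p\|_\infty$. Let $e_p, e_v, e_{pi} : \mathbb{R} \to \mathbb{R}^3$ be differentiable, let $R : \mathbb{R} \to SO(3)$, and let $e_{\mu,1} : \mathbb{R} \to \mathbb{R}^3$. Suppose that for all $t$: $\dot{e}_p = e_v$, $\dot{e}_{pi} = e_v + c_1 e_p$, and $\dot{e}_v = -k_{tp} e_p - k_{td} e_v - k_{ti}\,\mathrm{sat}_{\sigma_1}(e_{pi}) + \Delta_p + \tfrac{1}{m} R\, e_{\mu,1}$. Define $V_1 = \tfrac{1}{2} k_{tp}\|e_p\|^2 + \tfrac{1}{2}\|e_v\|^2 + c_1 e_p^\top e_v + \int_{\Delta_p/k_{ti}}^{e_{pi}} (k_{ti}\,\mathrm{sat}_{\sigma_1}(\gamma) - \Delta_p)\cdot d\gamma$. Then for all $t$, $\dot{V}_1 \le e_{\mu,1}^\top\big(\tfrac{c_1}{m}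 R^\top e_p + \tfrac{1}{m} R^\top e_v\big) - z_1^\top W_1 z_1$, where $z_1 = (\|e_p\|, \|e_v\|)^\top$ and $W_1 = \tfrac{1}{2}\begin{pmatrix} c_1 k_{tp} & -\tfrac{1}{2} c_1 k_{td} \\ -\tfrac{1}{2} c_1 k_{td} & k_{td} - c_1 \end{pmatrix}$. -/

import Mathlib

open Matrix

/-- Euclidean norm of a vector in `ℝ³`. -/
noncomputable def norm3 (v : Fin 3 → ℝ) : ℝ := Real.sqrt (v ⬝ᵥ v)

/-- The saturation function. -/
noncomputable def sat (σ y : ℝ) : ℝ := if |y| > σ then σ * Real.sign y else y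

/-- Membership in `SO(3)`: orthogonal with determinant one. -/
def SO3 (Q : Matrix (Fin 3) (Fin 3) ℝ) : Prop := Qᵀ * Q = 1 ∧ Q.det = 1

theorem sat_eq_max_min {σ : ℝ} (hσ : 0 < σ) (y : ℝ) : sat σ y = max (-σ) (min σ y) := by
  unfold sat
  split_ifs with h
  · rcases lt_abs.mp h with h | h
    · rw [Real.sign_of_pos (hσ.trans h), min_eq_left h.le, max_eq_right (by linarith), mul_one]
    · rw [Real.sign_of_neg (by linarith), min_eq_right (by linarith),
        max_eq_left (by linarith), mul_neg_one]
  · obtain ⟨h₁, h₂⟩ := abs_le.mp (not_lt.mp h)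
    rw [min_eq_right h₂, max_eq_right h₁]

theorem continuous_sat {σ : ℝ} (hσ : 0 < σ) : Continuous (sat σ) := by
  have : sat σ = fun y => max (-σ) (min σ y) := funext (sat_eq_max_min hσ)
  rw [this]
  fun_prop

theorem norm3_nonneg (v : Fin 3 → ℝ) : 0 ≤ norm3 v := Real.sqrt_nonneg _

theorem norm3_sq (v : Fin 3 → ℝ) : norm3 v ^ 2 = v ⬝ᵥ v :=
  Real.sq_sqrt (Finset.sum_nonneg fun i _ => mul_self_nonneg (v i))

theorem abs_dotProduct_le_norm3_mul (v w : Fin 3 → ℝ) : |v ⬝ᵥ w| ≤ norm3 v * norm3 w := by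
  refine abs_le_of_sq_le_sq ?_ (mul_nonneg (norm3_nonneg v) (norm3_nonneg w))
  rw [mul_pow, norm3_sq, norm3_sq]
  simpa [dotProduct, sq] using Finset.sum_mul_sq_le_sq_mul_sq Finset.univ v w

theorem HasDerivAt.dotProduct {f g : ℝ → Fin 3 → ℝ} {f' g' : Fin 3 → ℝ} {t : ℝ}
    (hf : HasDerivAt f f' t) (hg : HasDerivAt g g' t) :
    HasDerivAt (fun s => f s ⬝ᵥ g s) (f' ⬝ᵥ g t + f t ⬝ᵥ g') t := by
  have h := HasDerivAt.fun_sum (u := Finset.univ) fun i _ =>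
    (hasDerivAt_pi.mp hf i).mul (hasDerivAt_pi.mp hg i)
  rw [Finset.sum_add_distrib] at h
  exact h

/-- Nonnegativity of the quadratic form governing the decay of the position energy. -/
theorem position_form_nonneg {ktp ktd c1 : ℝ} (hktp : 0 < ktp) (hc1pos : 0 < c1)
    (hc1 : c1 < 4 * ktp * ktd / (ktd ^ 2 + 4 * ktp)) (p v : ℝ) :
    0 ≤ c1 * ktp * p ^ 2 - c1 * ktd * (p * v) + (ktd - c1) * v ^ 2 := by
  rw [lt_div_iff₀ (by positivity)] at hc1
  have h₁ : 0 ≤ c1 * (2 * ktp * p - ktd * v) ^ 2 := by positivity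
  have h₂ : 0 ≤ (4 * ktp * ktd - c1 * (ktd ^ 2 + 4 * ktp)) * v ^ 2 :=
    mul_nonneg (by linarith) (sq_nonneg v)
  refine nonneg_of_mul_nonneg_right (a := 4 * ktp) ?_ (by positivity)
  linarith

theorem stmt10 (m ktp ktd kti σ1 c1 : ℝ)
    (hm : 0 < m) (hktp : 0 < ktp) (hktd : 0 < ktd) (hkti : 0 < kti)
    (hσ1 : 0 < σ1) (hc1pos : 0 < c1)
    (hc1 : c1 < min (Real.sqrt ktp) (4 * ktp * ktd / (ktd ^ 2 + 4 * ktp)))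
    (Δp : Fin 3 → ℝ)
    -- `kti * σ1 > ‖Δp‖∞`
    (hΔp : ∀ i, |Δp i| < kti * σ1)
    (ep ev epi eμ1 : ℝ → Fin 3 → ℝ) (R : ℝ → Matrix (Fin 3) (Fin 3) ℝ)
    (hRso : ∀ t, SO3 (R t))
    (hep : ∀ t, HasDerivAt ep (ev t) t)
    (hepi : ∀ t, HasDerivAt epi (ev t + c1 • ep t) t)
    (hev : ∀ t, HasDerivAt ev
      ((-ktp) • ep t - ktd • ev t - kti • (fun i => sat σ1 (epi t i)) + Δp
        + (1 / m) • (R t).mulVec (eμ1 t)) t) :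
    let V1 : ℝ → ℝ := fun t =>
      (1/2) * ktp * norm3 (ep t) ^ 2 + (1/2) * norm3 (ev t) ^ 2
      + c1 * (ep t ⬝ᵥ ev t)
      + ∑ i, ∫ γ in (Δp i / kti)..(epi t i), (kti * sat σ1 γ - Δp i)
    let W1 : Matrix (Fin 2) (Fin 2) ℝ :=
      (1/2 : ℝ) • !![c1 * ktp, -(1/2) * c1 * ktd; -(1/2) * c1 * ktd, ktd - c1]
    ∀ t d, HasDerivAt V1 d t →
      d ≤ eμ1 t ⬝ᵥ ((c1 / m) • (R t)ᵀ.mulVec (ep t) + (1 / m) • (R t)ᵀ.mulVec (ev t))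
        - (![norm3 (ep t), norm3 (ev t)] ⬝ᵥ W1.mulVec ![norm3 (ep t), norm3 (ev t)]) := by
  intro V1 W1 t d hd
  have hV : HasDerivAt V1 _ t :=
    ((((((hep t).dotProduct (hep t)).const_mul (1 / 2 * ktp)).add
      (((hev t).dotProduct (hev t)).const_mul (1 / 2))).add
      (((hep t).dotProduct (hev t)).const_mul c1)).add
      (HasDerivAt.fun_sum (u := Finset.univ) fun i _ =>
        (intervalIntegral.integral_hasDerivAt_right
          (f := fun γ => kti * sat σ1 γ - Δp i) (a := Δp i / kti) (b := epi t i)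
          ((((continuous_sat hσ1).const_mul kti).sub continuous_const).intervalIntegrable _ _)
          (((continuous_sat hσ1).const_mul kti).sub
            continuous_const).stronglyMeasurable.stronglyMeasurableAtFilter
          (((continuous_sat hσ1).const_mul kti).sub continuous_const).continuousAt).comp t
        (hasDerivAt_pi.mp (hepi t) i))).congr_of_eventuallyEq
      (Filter.Eventually.of_forall fun s => by
        simp only [V1, norm3_sq]
        rfl)
  rw [hd.unique hV]
  have hcs := (abs_le.mp (abs_dotProduct_le_norm3_mul (ep t) (ev t))).1
  have hform := position_form_nonneg hktp hc1pos (hc1.trans_le (min_le_right _ _))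
    (norm3 (ep t)) (norm3 (ev t))
  have hcross : 0 ≤ c1 * ktd * (norm3 (ep t) * norm3 (ev t) + ep t ⬝ᵥ ev t) :=
    mul_nonneg (by positivity) (by linarith)
  have hp := norm3_sq (ep t)
  have hv := norm3_sq (ev t)
  have hW : ![norm3 (ep t), norm3 (ev t)] ⬝ᵥ W1.mulVec ![norm3 (ep t), norm3 (ev t)]
      = 1 / 2 * (c1 * ktp * norm3 (ep t) ^ 2 - c1 * ktd * (norm3 (ep t) * norm3 (ev t))
        + (ktd - c1) * norm3 (ev t) ^ 2) := by
    simp [W1, dotProduct, mulVec, Fin.sum_univ_two]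
    ring
  rw [hW]
  generalize norm3 (ep t) = p at *
  generalize norm3 (ev t) = v at *
  refine le_trans (b := eμ1 t ⬝ᵥ ((c1 / m) • (R t)ᵀ.mulVec (ep t) + (1 / m) • (R t)ᵀ.mulVec (ev t))
    - (c1 * ktp * p ^ 2 + c1 * ktd * (ep t ⬝ᵥ ev t) + (ktd - c1) * v ^ 2)) (le_of_eq ?_)
    (by linarith)
  rw [hp, hv]
  simp only [dotProduct, mulVec, Fin.sum_univ_three, Pi.add_apply, Pi.sub_apply, Pi.smul_apply,
    smul_eq_mul, transpose_apply]
  ring
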